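/- (The converse of Proposition 4.11 fails.) Take X = ℝ × ℝ (with the Euclidean distance dist) and parameter set E = ℝ, and define d : (X × ℝ) → (X × ℝ) → (ℝ → ℝ) by d (x, λ) (y, μ) = fun _ => |λ - μ| + dist x y. Then d is a soft metric on X with parameter set ℝ, but the soft self-mapping g (x, λ) = ((1/2) • x, 3 * λ) is not a soft contraction: there is no α : ℝ → ℝ with 0 ≤ α e < 1 for all e such that d (g p) (g q) e ≤ α e * d p q e for all soft points p, q and all e (even though, for each λ, x ↦ (1/2) • x is a contraction of the Euclidean metric on X). -/

import Mathlib

/-- A soft metric on `X` with parameter set `E`. -/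
def IsSoftMetric {X E : Type*} (d : X × E → X × E → E → ℝ) : Prop :=
  (∀ p q : X × E, ∀ e : E, 0 ≤ d p q e) ∧
  (∀ p q : X × E, (∀ e : E, d p q e = 0) ↔ p = q) ∧
  (∀ p q : X × E, d p q = d q p) ∧
  (∀ p q r : X × E, ∀ e : E, d p r e ≤ d p q e + d q r e)

/-- The soft open ball of center `p` and radius `ε`. -/
def SoftBall {X E : Type*} (d : X × E → X × E → E → ℝ) (p : X × E) (ε : E → ℝ) :
    Set (X × E) :=
  {q | ∀ e : E, d p q e < ε e}

/-- A set is soft open if every point has a soft ball around it inside the set. -/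
def SoftOpen {X E : Type*} (d : X × E → X × E → E → ℝ) (U : Set (X × E)) : Prop :=
  ∀ p ∈ U, ∃ ε : E → ℝ, (∀ e : E, 0 < ε e) ∧ SoftBall d p ε ⊆ U

/-- A set is soft closed if its complement is soft open. -/
def SoftClosed {X E : Type*} (d : X × E → X × E → E → ℝ) (C : Set (X × E)) : Prop :=
  SoftOpen d Cᶜ

/-- The soft closure of a set: intersection of all soft closed supersets. -/
def SoftClosure {X E : Type*} (d : X × E → X × E → E → ℝ) (S : Set (X × E)) :
    Set (X × E) :=
  ⋂₀ {C | SoftClosed d C ∧ S ⊆ C}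

/-- The soft interior of a set: union of all soft open subsets. -/
def SoftInterior {X E : Type*} (d : X × E → X × E → E → ℝ) (S : Set (X × E)) :
    Set (X × E) :=
  ⋃₀ {U | SoftOpen d U ∧ U ⊆ S}

/-- Soft continuity of `g` at the soft point `p`. -/
def SoftContinuousAt {X E Y E' : Type*} (d : X × E → X × E → E → ℝ)
    (ρ : Y × E' → Y × E' → E' → ℝ) (g : X × E → Y × E') (p : X × E) : Prop :=
  ∀ ε : E' → ℝ, (∀ e' : E', 0 < ε e') → ∃ δ : E → ℝ, (∀ e : E, 0 < δ e) ∧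
    ∀ q : X × E, (∀ e : E, d p q e < δ e) → (∀ e' : E', ρ (g p) (g q) e' < ε e')

/-- Soft convergence of a sequence of soft points. -/
def SoftTendsto {X E : Type*} (d : X × E → X × E → E → ℝ) (s : ℕ → X × E)
    (p : X × E) : Prop :=
  ∀ ε : E → ℝ, (∀ e : E, 0 < ε e) → ∃ N : ℕ, ∀ n ≥ N, ∀ e : E, d (s n) p e < ε e

/-- A soft Cauchy sequence. -/
def SoftCauchy {X E : Type*} (d : X × E → X × E → E → ℝ) (s : ℕ → X × E) : Prop :=
  ∀ ε : E → ℝ, (∀ e : E, 0 < ε e) → ∃ N : ℕ, ∀ m ≥ N, ∀ n ≥ N, ∀ e : E,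
    d (s m) (s n) e < ε e

/-- Completeness of the soft metric space. -/
def SoftComplete {X E : Type*} (d : X × E → X × E → E → ℝ) : Prop :=
  ∀ s : ℕ → X × E, SoftCauchy d s → ∃ p : X × E, SoftTendsto d s p

/-- The sum of the distances between parameters and between base points is a soft metric. -/
theorem isSoftMetric_abs_add_dist (X : Type*) [MetricSpace X] :
    IsSoftMetric (fun (p q : X × ℝ) => fun _ : ℝ => |p.2 - q.2| + dist p.1 q.1) := by
  refine ⟨fun p q _ => by positivity, fun p q => ⟨fun h => ?_, ?_⟩, fun p q => ?_,
    fun p q r _ => ?_⟩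
  · obtain ⟨h2, h1⟩ := (add_eq_zero_iff_of_nonneg (abs_nonneg _) dist_nonneg).1 (h 0)
    exact Prod.ext (dist_eq_zero.1 h1) (sub_eq_zero.1 (abs_eq_zero.1 h2))
  · rintro rfl
    simp
  · simp only [abs_sub_comm p.2, dist_comm p.1]
  · linarith [abs_sub_le p.2 q.2 r.2, dist_triangle p.1 q.1 r.1]

/-- the converse of Proposition 4.11 fails. -/
theorem softContraction_converse_fails :
    IsSoftMetric (fun (p q : (ℝ × ℝ) × ℝ) => fun _ : ℝ => |p.2 - q.2| + dist p.1 q.1) ∧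
    (∀ x y : ℝ × ℝ, dist ((1 / 2 : ℝ) • x) ((1 / 2 : ℝ) • y) ≤ (1 / 2) * dist x y) ∧
    ¬ ∃ α : ℝ → ℝ, (∀ e : ℝ, 0 ≤ α e ∧ α e < 1) ∧
      ∀ p q : (ℝ × ℝ) × ℝ, ∀ e : ℝ,
        (fun _ : ℝ => |((1 / 2 : ℝ) • p.1, 3 * p.2).2 - ((1 / 2 : ℝ) • q.1, 3 * q.2).2|
          + dist ((1 / 2 : ℝ) • p.1, 3 * p.2).1 ((1 / 2 : ℝ) • q.1, 3 * q.2).1) e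
          ≤ α e * (fun _ : ℝ => |p.2 - q.2| + dist p.1 q.1) e := by
  refine ⟨isSoftMetric_abs_add_dist (ℝ × ℝ), fun x y => ?_, ?_⟩
  · rw [dist_smul₀]
    norm_num
  · rintro ⟨α, hα, h⟩
    have h01 := h (0, 1) (0, 0) 0
    norm_num at h01
    linarith [(hα 0).2]
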